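/- Suppose we observe K distinct pairs of marginals (μ^(k),ν^(k)) ∈ Δ_N × Δ_M, values α^(k) ∈ ℝ, plans π^(k) ∈ Π(μ^(k),ν^(k)), and extreme points u^(1,k),…,u^(L_k,k) ∈ EP(μ^(k),ν^(k)) representing π^(k). Call c' ∈ ℝ^{N×M} consistent if ⟨c',π^(k)⟩ = OT_{c'}(μ^(k),ν^(k)) = α^(k) for all k. Then the set of consistent matrices equals the solution set of the system { ⟨c', u^(ℓ,k)⟩ = α^(k) for all ℓ ∈ {1,…,L_k} and k, and ⟨c', v⟩ ≥ α^(k) for all v ∈ EP(μ^(k),ν^(k)) \ {u^(ℓ,k) : ℓ ∈ {1,…,L_k}} and all k }. In particular, there is exactly one consistent matrix if and only if this system has a unique solution. -/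

import Mathlib

open Finset

noncomputable section

/-- Frobenius inner product of two `N × M` real matrices. -/
def frob {N M : ℕ} (c π : Matrix (Fin N) (Fin M) ℝ) : ℝ := ∑ i, ∑ j, c i j * π i j

/-- The set `Π(μ,ν)` of transport plans between `μ` and `ν`. -/
def Plans {N M : ℕ} (μ : Fin N → ℝ) (ν : Fin M → ℝ) : Set (Matrix (Fin N) (Fin M) ℝ) :=
  {π | (∀ i j, 0 ≤ π i j) ∧ (∀ i, ∑ j, π i j = μ i) ∧ (∀ j, ∑ i, π i j = ν j)}

/-- The optimal transport cost `OT_c(μ,ν)`. -/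
def OTcost {N M : ℕ} (c : Matrix (Fin N) (Fin M) ℝ) (μ : Fin N → ℝ) (ν : Fin M → ℝ) : ℝ :=
  sInf (frob c '' Plans μ ν)

/-- The set `EP(μ,ν)` of extreme points of the transport polytope. -/
def EP {N M : ℕ} (μ : Fin N → ℝ) (ν : Fin M → ℝ) : Set (Matrix (Fin N) (Fin M) ℝ) :=
  Set.extremePoints ℝ (Plans μ ν)

/-- The Frobenius product with a fixed matrix, as a linear functional. -/
def frobLinear {N M : ℕ} (c : Matrix (Fin N) (Fin M) ℝ) :
    Matrix (Fin N) (Fin M) ℝ →ₗ[ℝ] ℝ where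
  toFun x := frob c x
  map_add' x y := by
    simp only [frob, Matrix.add_apply, mul_add, Finset.sum_add_distrib]
  map_smul' r x := by
    simp only [frob, Matrix.smul_apply, smul_eq_mul, Finset.mul_sum, RingHom.id_apply]
    exact Finset.sum_congr rfl fun i _ => Finset.sum_congr rfl fun j _ => by ring

theorem frob_sum_smul {N M : ℕ} {ι : Type*} [Fintype ι] (c : Matrix (Fin N) (Fin M) ℝ)
    (lam : ι → ℝ) (u : ι → Matrix (Fin N) (Fin M) ℝ) :
    frob c (∑ l, lam l • u l) = ∑ l, lam l * frob c (u l) := by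
  change frobLinear c _ = ∑ l, lam l * frobLinear c (u l)
  simp only [map_sum, map_smul, smul_eq_mul]

theorem convex_plans {N M : ℕ} (μ : Fin N → ℝ) (ν : Fin M → ℝ) :
    Convex ℝ (Plans μ ν) := by
  rintro x ⟨hx, hxμ, hxν⟩ y ⟨hy, hyμ, hyν⟩ a b ha hb hab
  refine ⟨fun i j => add_nonneg (mul_nonneg ha (hx i j)) (mul_nonneg hb (hy i j)),
    fun i => ?_, fun j => ?_⟩
  · simp only [Matrix.add_apply, Matrix.smul_apply, smul_eq_mul, Finset.sum_add_distrib,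
      ← Finset.mul_sum, hxμ, hyμ]
    rw [← add_mul, hab, one_mul]
  · simp only [Matrix.add_apply, Matrix.smul_apply, smul_eq_mul, Finset.sum_add_distrib,
      ← Finset.mul_sum, hxν, hyν]
    rw [← add_mul, hab, one_mul]

theorem isCompact_plans {N M : ℕ} (μ : Fin N → ℝ) (ν : Fin M → ℝ) :
    IsCompact (Plans μ ν) := by
  have hbox : IsCompact {x : Matrix (Fin N) (Fin M) ℝ | ∀ i j, x i j ∈ Set.Icc 0 (μ i)} :=
    isCompact_pi_infinite fun i => isCompact_pi_infinite fun _ => isCompact_Icc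
  refine hbox.of_isClosed_subset ?_ ?_
  · have h : (Plans μ ν) =
        (⋂ i, ⋂ j, {x | 0 ≤ x i j}) ∩ ((⋂ i, {x | ∑ j, x i j = μ i}) ∩
          ⋂ j, {x | ∑ i, x i j = ν j}) := by
      ext x
      simp only [Set.mem_inter_iff, Set.mem_iInter, Set.mem_ofPred_eq]
      rfl
    rw [h]
    refine (isClosed_iInter fun i => isClosed_iInter fun j => ?_).inter
      ((isClosed_iInter fun i => ?_).inter (isClosed_iInter fun j => ?_))
    · exact isClosed_le (by fun_prop) (by fun_prop)
    · exact isClosed_eq (by fun_prop) (by fun_prop)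
    · exact isClosed_eq (by fun_prop) (by fun_prop)
  · rintro x ⟨hx, hxμ, -⟩
    refine fun i j => ⟨hx i j, ?_⟩
    rw [← hxμ i]
    exact Finset.single_le_sum (f := fun j => x i j) (fun j _ => hx i j) (Finset.mem_univ j)

/-- By Krein–Milman, a lower bound for a linear cost on the extreme points of the transport
polytope is a lower bound on the whole polytope. -/
theorem le_frob_of_le_on_extremePoints {N M : ℕ} {μ : Fin N → ℝ} {ν : Fin M → ℝ}
    {c : Matrix (Fin N) (Fin M) ℝ} {a : ℝ} (h : ∀ v ∈ EP μ ν, a ≤ frob c v)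
    {x : Matrix (Fin N) (Fin M) ℝ} (hx : x ∈ Plans μ ν) : a ≤ frob c x := by
  have : LocallyConvexSpace ℝ (Matrix (Fin N) (Fin M) ℝ) :=
    inferInstanceAs (LocallyConvexSpace ℝ (Fin N → Fin M → ℝ))
  have hKM := closure_convexHull_extremePoints (isCompact_plans μ ν) (convex_plans μ ν)
  have hcl : IsClosed {y : Matrix (Fin N) (Fin M) ℝ | a ≤ frobLinear c y} :=
    isClosed_le continuous_const (frobLinear c).continuous_of_finiteDimensional
  have hcv : Convex ℝ {y : Matrix (Fin N) (Fin M) ℝ | a ≤ frobLinear c y} :=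
    convex_halfSpace_ge (frobLinear c).isLinear a
  exact closure_minimal (convexHull_min (fun v hv => h v hv) hcv) hcl (hKM.symm.subset hx)

theorem bddBelow_frob_image_plans {N M : ℕ} (c : Matrix (Fin N) (Fin M) ℝ)
    (μ : Fin N → ℝ) (ν : Fin M → ℝ) : BddBelow (frob c '' Plans μ ν) :=
  ((isCompact_plans μ ν).image (frobLinear c).continuous_of_finiteDimensional).bddBelow

/-- A plan attains the value `a = OT_c(μ,ν)` iff `a` is its cost and bounds all costs below. -/
theorem frob_eq_and_OTcost_eq_iff {N M : ℕ} {μ : Fin N → ℝ} {ν : Fin M → ℝ}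
    {c π : Matrix (Fin N) (Fin M) ℝ} {a : ℝ} (hπ : π ∈ Plans μ ν) :
    (frob c π = a ∧ OTcost c μ ν = a) ↔ frob c π = a ∧ ∀ x ∈ Plans μ ν, a ≤ frob c x := by
  refine and_congr_right fun ha => ⟨fun h x hx => ?_, fun h => ?_⟩
  · rw [← h]
    exact csInf_le (bddBelow_frob_image_plans c μ ν) (Set.mem_image_of_mem _ hx)
  · refine IsLeast.csInf_eq ⟨⟨π, hπ, ha⟩, ?_⟩
    rintro _ ⟨x, hx, rfl⟩
    exact h x hx

/-- A convex combination with positive weights of values `≥ a` equals `a` iff all values do. -/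
theorem sum_mul_eq_iff_of_le {ι : Type*} [Fintype ι] {lam f : ι → ℝ} {a : ℝ}
    (hpos : ∀ l, 0 < lam l) (hsum : ∑ l, lam l = 1) (hf : ∀ l, a ≤ f l) :
    ∑ l, lam l * f l = a ↔ ∀ l, f l = a := by
  have ha : ∑ l, lam l * a = a := by rw [← Finset.sum_mul, hsum, one_mul]
  refine ⟨fun h l => ?_, fun h => by simp only [h, ha]⟩
  have hle : ∀ l ∈ Finset.univ, lam l * a ≤ lam l * f l := fun l _ =>
    mul_le_mul_of_nonneg_left (hf l) (hpos l).le
  have := (Finset.sum_eq_sum_iff_of_le hle).1 (ha.trans h.symm) l (Finset.mem_univ l)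
  exact (mul_left_cancel₀ (hpos l).ne' this).symm

/-- A plan represented by extreme points `u l` is optimal with value `a` iff every `u l` has
cost `a` and every other extreme point has cost at least `a`. -/
theorem frob_eq_and_OTcost_eq_iff_extremePoints {N M : ℕ} {ι : Type*} [Fintype ι]
    {μ : Fin N → ℝ} {ν : Fin M → ℝ} {c π : Matrix (Fin N) (Fin M) ℝ} {a : ℝ}
    (hπ : π ∈ Plans μ ν) {u : ι → Matrix (Fin N) (Fin M) ℝ} (hu : ∀ l, u l ∈ EP μ ν)
    {lam : ι → ℝ} (hpos : ∀ l, 0 < lam l) (hsum : ∑ l, lam l = 1)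
    (hrep : π = ∑ l, lam l • u l) :
    (frob c π = a ∧ OTcost c μ ν = a) ↔
      (∀ l, frob c (u l) = a) ∧ ∀ v ∈ EP μ ν, v ∉ Set.range u → a ≤ frob c v := by
  rw [frob_eq_and_OTcost_eq_iff hπ, hrep, frob_sum_smul]
  constructor
  · rintro ⟨hval, hle⟩
    exact ⟨(sum_mul_eq_iff_of_le hpos hsum fun l => hle _ (hu l).1).1 hval,
      fun v hv _ => hle v hv.1⟩
  · rintro ⟨hval, hle⟩
    refine ⟨(sum_mul_eq_iff_of_le hpos hsum fun l => (hval l).ge).2 hval, fun x hx => ?_⟩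
    refine le_frob_of_le_on_extremePoints (fun v hv => ?_) hx
    by_cases hvu : v ∈ Set.range u
    · obtain ⟨l, rfl⟩ := hvu
      exact (hval l).ge
    · exact hle v hv hvu

/-- Identifiability from total costs and OT plans: the set of consistent cost matrices is the
solution set of a linear system; in particular the consistent cost matrix is unique iff that
system has a unique solution. -/
theorem stmt10 (N M K : ℕ) (hN : 1 ≤ N) (hM : 1 ≤ M)
    (μ : Fin K → Fin N → ℝ) (ν : Fin K → Fin M → ℝ)
    (hμ : ∀ k, μ k ∈ stdSimplex ℝ (Fin N)) (hν : ∀ k, ν k ∈ stdSimplex ℝ (Fin M))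
    (hdist : Function.Injective (fun k => (μ k, ν k)))
    (α : Fin K → ℝ)
    (π : Fin K → Matrix (Fin N) (Fin M) ℝ) (hπ : ∀ k, π k ∈ Plans (μ k) (ν k))
    (L : Fin K → ℕ) (u : (k : Fin K) → Fin (L k) → Matrix (Fin N) (Fin M) ℝ)
    (hu : ∀ k ℓ, u k ℓ ∈ EP (μ k) (ν k))
    (hrep : ∀ k, ∃ lam : Fin (L k) → ℝ,
      (∀ ℓ, 0 < lam ℓ) ∧ (∑ ℓ, lam ℓ = 1) ∧ π k = ∑ ℓ, lam ℓ • u k ℓ) :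
    ({c' : Matrix (Fin N) (Fin M) ℝ |
        ∀ k, frob c' (π k) = α k ∧ OTcost c' (μ k) (ν k) = α k} =
      {c' : Matrix (Fin N) (Fin M) ℝ |
        (∀ k ℓ, frob c' (u k ℓ) = α k) ∧
        ∀ k, ∀ v ∈ EP (μ k) (ν k), v ∉ Set.range (u k) → α k ≤ frob c' v}) ∧
    ((∃! c' : Matrix (Fin N) (Fin M) ℝ,
        ∀ k, frob c' (π k) = α k ∧ OTcost c' (μ k) (ν k) = α k) ↔
      (∃! c' : Matrix (Fin N) (Fin M) ℝ,
        (∀ k ℓ, frob c' (u k ℓ) = α k) ∧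
        ∀ k, ∀ v ∈ EP (μ k) (ν k), v ∉ Set.range (u k) → α k ≤ frob c' v)) := by
  have key : ∀ c' : Matrix (Fin N) (Fin M) ℝ,
      (∀ k, frob c' (π k) = α k ∧ OTcost c' (μ k) (ν k) = α k) ↔
        (∀ k ℓ, frob c' (u k ℓ) = α k) ∧
          ∀ k, ∀ v ∈ EP (μ k) (ν k), v ∉ Set.range (u k) → α k ≤ frob c' v := by
    intro c'
    rw [← forall_and]
    refine forall_congr' fun k => ?_
    obtain ⟨lam, hpos, hsum, hk⟩ := hrep k
    exact frob_eq_and_OTcost_eq_iff_extremePoints (hπ k) (hu k) hpos hsum hk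
  exact ⟨Set.ext key, existsUnique_congr key⟩
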